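/- Let G be a finite group and consider a pushout square in the category of pointed G-simplicial sets with left vertical map f : A → B a monomorphism, top map A → X, and pushout Y. Then applying the G-fixed points functor (−)^G yields again a pushout square of pointed simplicial sets, with left map A^G → B^G, top map A^G → X^G, and pushout Y^G. -/

import Mathlib

open CategoryTheory CategoryTheory.Limits Opposite

universe w v u v₁ u₁ v₂ u₂ v₃ u₃

set_option linter.unusedVariables false

namespace PositiveStableCofibrations

/-! ## Pointed simplicial sets

We model pointed simplicial sets as the coslice category of simplicial sets under the
(terminal) point. -/

noncomputable def ssetPt : SSet.{0} := ⊤_ SSet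

/-- The category of pointed simplicial sets. -/
abbrev PtdSSet := Under ssetPt

/-- A map of pointed simplicial sets is a monomorphism iff it is levelwise injective. -/
def IsLevelwiseInjective {X Y : PtdSSet} (f : X ⟶ Y) : Prop :=
  ∀ k : SimplexCategoryᵒᵖ, Function.Injective (f.right.app k)

/-! ## Statement 18 (Proposition 2.3 of the paper)

For a pushout square of pointed `G`-simplicial sets whose left vertical map `f : A ⟶ B` is a
monomorphism, applying the `G`-fixed points functor `(−)^G` (the limit over `G`) again yields
a pushout square. -/

/-- In a pushout square of types, the bottom map is injective on the complement of the range
of the left map. -/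
lemma eq_of_isPushout_of_notMem_range {A B X Y : Type} {t : A ⟶ X} {f : A ⟶ B} {u : X ⟶ Y}
    {v : B ⟶ Y} (h : IsPushout t f u v) {b b' : B} (hb : b ∉ Set.range f) (hv : v b = v b') :
    b = b' := by
  let p : X ⟶ (Prop : Type) := TypeCat.ofHom fun _ ↦ False
  let q : B ⟶ (Prop : Type) := TypeCat.ofHom fun x ↦ b = x
  have w : t ≫ p = f ≫ q := by
    ext a
    exact ⟨False.elim, fun e : b = f a ↦ hb ⟨a, e.symm⟩⟩
  have hq (x : B) : h.desc p q w (v x) = (b = x) := ConcreteCategory.congr_hom (h.inr_desc p q w) x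
  rw [← hq b', ← hv, hq b]

section FixedPoints

variable {G : Type} [Group G]

/-- Every fixed point of a `G`-set comes from the limit over `G`. -/
lemma exists_limit_π_eq {F : SingleObj G ⥤ Type} (x : F.obj (SingleObj.star G))
    (hx : ∀ g : SingleObj.star G ⟶ SingleObj.star G, F.map g x = x) :
    ∃ y : limit F, limit.π F (SingleObj.star G) y = x :=
  ⟨(Types.limitEquivSections F).symm ⟨fun _ ↦ x, fun {_ _} g ↦ hx g⟩,
    Types.limitEquivSections_symm_apply F _ _⟩

lemma limit_π_injective (F : SingleObj G ⥤ Type) :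
    Function.Injective (limit.π F (SingleObj.star G)) :=
  fun _ _ h ↦ Types.limit_ext _ _ _ fun _ ↦ h

/-- Fixed points of `G`-sets preserve pushouts along injective maps. -/
lemma isPushout_lim_map_of_injective {A B X Y : SingleObj G ⥤ Type}
    {t : A ⟶ X} {f : A ⟶ B} {u : X ⟶ Y} {v : B ⟶ Y} (h : IsPushout t f u v)
    (hf : Function.Injective (f.app (SingleObj.star G))) :
    IsPushout (lim.map t) (lim.map f) (lim.map u) (lim.map v) := by
  have hs := h.app (SingleObj.star G)
  have hp : IsPullback t f u v := .of_forall_isPullback_app fun _ ↦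
    (Types.isPullback_of_isPushout hs.flip hf).flip
  have hu : Function.Injective (u.app (SingleObj.star G)) :=
    Types.pushoutCocone_inr_injective_of_isColimit hs.flip.isColimit hf
  have : ∀ j, Mono (u.app j) := fun _ ↦ (mono_iff_injective _).2 hu
  have : Mono u := NatTrans.mono_of_mono_app u
  have hpi {E F : SingleObj G ⥤ Type} (k : E ⟶ F) (z : limit E) :
      limit.π F (SingleObj.star G) (lim.map k z) =
        k.app (SingleObj.star G) (limit.π E (SingleObj.star G) z) :=
    ConcreteCategory.congr_hom (limMap_π k (SingleObj.star G)) z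
  have hfix {F : SingleObj G ⥤ Type} (z : limit F) (g : SingleObj.star G ⟶ SingleObj.star G) :
      F.map g (limit.π F _ z) = limit.π F _ z :=
    ConcreteCategory.congr_hom (limit.w F g) z
  have hnat {E F : SingleObj G ⥤ Type} (k : E ⟶ F) (g : SingleObj.star G ⟶ SingleObj.star G)
      (e : E.obj (SingleObj.star G)) : k.app _ (E.map g e) = F.map g (k.app _ e) :=
    ConcreteCategory.congr_hom (k.naturality g) e
  /- The complement of the range of `f` is stable under the action of `G`. -/
  have hcompl (b : B.obj (SingleObj.star G)) (hb : b ∉ Set.range (f.app (SingleObj.star G)))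
      (g : SingleObj.star G ⟶ SingleObj.star G) :
      B.map g b ∉ Set.range (f.app (SingleObj.star G)) := by
    rintro ⟨a, ha⟩
    refine hb ⟨A.map (inv g) a, ?_⟩
    rw [hnat, ha]
    simp [← ConcreteCategory.comp_apply]
  refine Types.isPushout_of_isPullback_of_mono' (hp.map lim) ?_ ?_
  · refine Set.eq_univ_of_forall fun y ↦ ?_
    obtain ⟨x, hx⟩ | ⟨b, hb, hbf⟩ :=
      Types.eq_or_eq_of_isPushout' hs (limit.π Y (SingleObj.star G) y)
    · obtain ⟨z, rfl⟩ := exists_limit_π_eq x fun g ↦ hu (by rw [hnat, hx, hfix])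
      exact Or.inl ⟨z, limit_π_injective Y (by rw [hpi, hx])⟩
    · obtain ⟨z, rfl⟩ := exists_limit_π_eq b fun g ↦
        eq_of_isPushout_of_notMem_range hs (hcompl b hbf g) (by rw [hnat, hb, hfix])
      exact Or.inr ⟨z, limit_π_injective Y (by rw [hpi, hb])⟩
  · intro b b' hb _ e
    refine limit_π_injective B (eq_of_isPushout_of_notMem_range hs ?_ (by rw [← hpi, e, hpi]))
    rintro ⟨a, ha⟩
    obtain ⟨z, rfl⟩ := exists_limit_π_eq a fun g ↦ hf (by rw [hnat, ha, hfix])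
    exact hb ⟨z, limit_π_injective B (by rw [hpi, ha])⟩

end FixedPoints

theorem fixedPoints_preserve_pushout_along_mono (G : Type) [Group G]
    {A B X Y : SingleObj G ⥤ PtdSSet}
    (t : A ⟶ X) (f : A ⟶ B) (u : X ⟶ Y) (v : B ⟶ Y)
    (hsq : IsPushout t f u v)
    (hf : IsLevelwiseInjective (f.app (SingleObj.star G))) :
    IsPushout (lim.map t) (lim.map f) (lim.map u) (lim.map v) := by
  refine .of_map (Under.forget ssetPt) (by rw [← Functor.map_comp, hsq.w, Functor.map_comp])
    (.of_forall_isPushout_app fun k ↦ ?_)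
  let E : PtdSSet ⥤ Type := Under.forget ssetPt ⋙ (evaluation SimplexCategoryᵒᵖ Type).obj k
  let W := (Functor.whiskeringRight (SingleObj G) PtdSSet Type).obj E
  have h : IsPushout (W.map t) (W.map f) (W.map u) (W.map v) :=
    .of_forall_isPushout_app fun j ↦ (hsq.app j).map E
  let e : lim ⋙ E ≅ W ⋙ lim := preservesLimitNatIso E
  exact (isPushout_lim_map_of_injective h (hf k)).of_iso (e.app A).symm (e.app X).symm
    (e.app B).symm (e.app Y).symm (e.inv.naturality t) (e.inv.naturality f) (e.inv.naturality u)
    (e.inv.naturality v)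

end PositiveStableCofibrations
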